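/- arXiv:1312.6886 — 2 statements merged into one kernel-verified Lean document; each statement's English description precedes it below -/
import Mathlib

section
/- Let a finite group G act on a finite nonempty set S, and let δ = (1/|S|)·Σ_{s∈S}|Stab_G(s)| − 1 be the deviation of the average stabilizer size from 1. If R denotes the set of regular orbits (orbits of size |G|) and S/G the set of all orbits, then |R| ≥ ((1−δ)/(1+δ))·|S/G|. -/
theorem burnside_aux {G S : Type*} [Group G] [Finite G] [Fintype S] [MulAction G S] :
    ∑ s : S, Nat.card (MulAction.stabilizer G s) =
      Nat.card (MulAction.orbitRel.Quotient G S) * Nat.card G := by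
  classical
  have e := MulAction.sigmaFixedByEquivOrbitsProdGroup G S
  have e2 : (Σ s : S, MulAction.stabilizer G s) ≃ (Σ g : G, MulAction.fixedBy S g) :=
    { toFun := fun x => ⟨x.2.1, x.1, x.2.2⟩
      invFun := fun x => ⟨x.2.1, x.1, x.2.2⟩
      left_inv := fun _ => rfl
      right_inv := fun _ => rfl }
  rw [← Nat.card_sigma, Nat.card_congr (e2.trans e), Nat.card_prod]

theorem orbit_aux {G S : Type*} [Group G] [Finite G] [Fintype S] [MulAction G S]
    (o : MulAction.orbitRel.Quotient G S) [Decidable (Nat.card o.orbit = Nat.card G)] :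
    2 * Nat.card o.orbit ≤ Nat.card G * (1 + if Nat.card o.orbit = Nat.card G then 1 else 0) := by
  have hd : Nat.card o.orbit ∣ Nat.card G := by
    induction o using Quotient.inductionOn' with
    | h s =>
      rw [MulAction.orbitRel.Quotient.orbit_mk, Nat.card_coe_set_eq, ← MulAction.index_stabilizer]
      exact Subgroup.index_dvd_card _
  have hp : 0 < Nat.card G := Nat.card_pos
  obtain ⟨k, hk⟩ := hd
  split_ifs with h
  · omega
  · have : 2 ≤ k := by
      by_contra hlt
      have : k = 0 ∨ k = 1 := by omega
      rcases this with rfl | rfl <;> omega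
    nlinarith

theorem stmt_16 {G S : Type*} [Group G] [Finite G] [Fintype S] [Nonempty S]
    [MulAction G S] (δ : ℝ)
    (hδ : δ = (∑ s : S, (Nat.card (MulAction.stabilizer G s) : ℝ)) /
        (Fintype.card S : ℝ) - 1) :
    (1 - δ) / (1 + δ) * (Nat.card (MulAction.orbitRel.Quotient G S) : ℝ) ≤
      ({o : MulAction.orbitRel.Quotient G S |
          Nat.card o.orbit = Nat.card G}.ncard : ℝ) := by
  classical
  haveI : Finite (MulAction.orbitRel.Quotient G S) := Quotient.finite _
  haveI := Fintype.ofFinite (MulAction.orbitRel.Quotient G S)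
  have hb := burnside_aux (G := G) (S := S)
  have hS : Fintype.card S = ∑ o : MulAction.orbitRel.Quotient G S, Nat.card o.orbit := by
    rw [← Nat.card_eq_fintype_card, Nat.card_congr (MulAction.selfEquivSigmaOrbits' G S),
      Nat.card_sigma]
  have key : 2 * Fintype.card S ≤ Nat.card G * (Nat.card (MulAction.orbitRel.Quotient G S) +
      {o : MulAction.orbitRel.Quotient G S | Nat.card o.orbit = Nat.card G}.ncard) := by
    rw [hS, Finset.mul_sum]
    refine (Finset.sum_le_sum fun o _ => orbit_aux o).trans (le_of_eq ?_)
    rw [← Finset.mul_sum, Finset.sum_add_distrib, Finset.sum_boole, Set.ncard_eq_toFinset_card']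
    simp
  have hN : 0 < Nat.card (MulAction.orbitRel.Quotient G S) := by
    haveI : Nonempty (MulAction.orbitRel.Quotient G S) :=
      ⟨Quotient.mk'' (Classical.arbitrary S)⟩
    exact Nat.card_pos
  have hg : 0 < Nat.card G := Nat.card_pos
  have hn : 0 < Fintype.card S := Fintype.card_pos
  rw [← Nat.cast_sum, hb] at hδ
  generalize Set.ncard _ = R at *
  generalize Nat.card (MulAction.orbitRel.Quotient G S) = N at *
  generalize Nat.card G = g at *
  generalize Fintype.card S = n at *
  have hN' : (0:ℝ) < N := by exact_mod_cast hN
  have hg' : (0:ℝ) < g := by exact_mod_cast hg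
  have hn' : (0:ℝ) < n := by exact_mod_cast hn
  have key' : 2 * (n:ℝ) ≤ g * (N + R) := by exact_mod_cast key
  have : (1 - δ) / (1 + δ) * (N:ℝ) = 2 * n / g - N := by
    subst hδ
    push_cast
    have : 1 + ((N:ℝ) * g / n - 1) = N * g / n := by ring
    rw [this]
    field_simp
    ring
  rw [this, sub_le_iff_le_add, div_le_iff₀ hg']
  linarith
end

section
/- Let σ be a permutation of a finite set Ω with |Ω| = n, let j_k(σ) denote the number of cycles of σ of length k (so j_1(σ) is the number of fixed points), and let α_m(σ) denote the number of σ-invariant m-element subsets of Ω. Then for every commutative ring element t (in particular as an identity of polynomials), Σ_{m=0}^{n} α_m(σ)·t^m = Π_{k≥1} (1 + t^k)^{j_k(σ)}; equivalently, Σ over σ-invariant subsets x ⊆ Ω of t^{|x|} equals (1+t)^{j_1(σ)} · Π_{k ∈ cycleType(σ)} (1 + t^k), where cycleType(σ) is the multiset of lengths (≥ 2) of the nontrivial cycles of σ. -/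
open Finset

lemma inv_iff_aux {Ω : Type*} [Fintype Ω] [DecidableEq Ω] (σ : Equiv.Perm Ω) (x : Finset Ω) :
    x.image ⇑σ = x ↔ ∀ a b, σ.SameCycle a b → a ∈ x → b ∈ x := by
  constructor
  · intro h a b hab ha
    obtain ⟨i, -, rfl⟩ := hab.exists_pow_eq'
    induction i with
    | zero => simpa using ha
    | succ k ih =>
      rw [pow_succ', Equiv.Perm.mul_apply, ← h]
      exact mem_image_of_mem _ (ih ⟨k, by simp⟩)
  · intro h
    apply eq_of_subset_of_card_le
    · intro b hb
      obtain ⟨a, ha, rfl⟩ := mem_image.1 hb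
      exact h a _ ⟨1, by simp⟩ ha
    · rw [card_image_of_injective _ σ.injective]

open Classical in
/-- the orbit of a point -/
noncomputable def blockAux {Ω : Type*} [Fintype Ω] (σ : Equiv.Perm Ω) (a : Ω) : Finset Ω :=
  univ.filter (fun b => σ.SameCycle a b)

lemma mem_blockAux {Ω : Type*} [Fintype Ω] (σ : Equiv.Perm Ω) (a b : Ω) :
    b ∈ blockAux σ a ↔ σ.SameCycle a b := by simp [blockAux]

lemma blockAux_eq {Ω : Type*} [Fintype Ω] (σ : Equiv.Perm Ω) (a b : Ω) (h : σ.SameCycle a b) :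
    blockAux σ a = blockAux σ b := by
  ext c
  rw [mem_blockAux, mem_blockAux]
  exact ⟨fun h' => h.symm.trans h', fun h' => h.trans h'⟩

lemma sum_inv_aux {Ω : Type*} [Fintype Ω] [DecidableEq Ω] (σ : Equiv.Perm Ω)
    {R : Type*} [CommRing R] (t : R) :
    ∑ x ∈ (univ : Finset (Finset Ω)).filter (fun x => x.image ⇑σ = x), t ^ x.card =
      ∏ B ∈ univ.image (blockAux σ), (1 + t ^ B.card) := by
  rw [Finset.prod_one_add]
  symm
  have key : ∀ S ⊆ univ.image (blockAux σ), ∀ a, a ∈ S.biUnion id ↔ blockAux σ a ∈ S := by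
    intro S hS a
    rw [mem_biUnion]
    constructor
    · rintro ⟨B, hB, ha⟩
      obtain ⟨b, -, rfl⟩ := mem_image.1 (hS hB)
      rw [← blockAux_eq σ b a ((mem_blockAux _ _ _).1 ha)]
      exact hB
    · intro h
      exact ⟨_, h, (mem_blockAux _ _ _).2 (Equiv.Perm.SameCycle.refl _ _)⟩
  refine Finset.sum_bij' (fun S _ => S.biUnion id) (fun x _ => x.image (blockAux σ)) ?_ ?_ ?_ ?_ ?_
  · intro S hS
    rw [mem_powerset] at hS
    simp only [mem_filter, mem_univ, true_and]
    rw [inv_iff_aux]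
    intro a b hab
    rw [key S hS, key S hS, blockAux_eq σ a b hab]
    exact id
  · intro x _
    rw [mem_powerset]
    exact image_subset_image (subset_univ _)
  · intro S hS
    rw [mem_powerset] at hS
    ext B
    rw [mem_image]
    constructor
    · rintro ⟨a, ha, rfl⟩
      exact (key S hS a).1 ha
    · intro hB
      obtain ⟨b, -, rfl⟩ := mem_image.1 (hS hB)
      exact ⟨b, (key S hS b).2 hB, rfl⟩
  · intro x hx
    have hx' := (inv_iff_aux σ x).1 (mem_filter.1 hx).2
    ext a
    rw [mem_biUnion]
    constructor
    · rintro ⟨B, hB, ha⟩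
      obtain ⟨b, hb, rfl⟩ := mem_image.1 hB
      exact hx' b a ((mem_blockAux _ _ _).1 ha) hb
    · intro h
      exact ⟨_, mem_image_of_mem _ h, (mem_blockAux _ _ _).2 (Equiv.Perm.SameCycle.refl _ _)⟩
  · intro S hS
    rw [mem_powerset] at hS
    rw [card_biUnion, Finset.prod_pow_eq_pow_sum]
    · rfl
    · intro B hB C hC hne
      obtain ⟨b, -, rfl⟩ := mem_image.1 (hS hB)
      obtain ⟨c, -, rfl⟩ := mem_image.1 (hS hC)
      show Disjoint (blockAux σ b) (blockAux σ c)
      rw [Finset.disjoint_left]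
      intro a h1 h2
      rw [mem_blockAux] at h1 h2
      exact hne (blockAux_eq σ b c (h1.trans h2.symm))

lemma blocks_eq_aux {Ω : Type*} [Fintype Ω] [DecidableEq Ω] (σ : Equiv.Perm Ω) :
    univ.image (blockAux σ) = (univ.filter (fun ω => σ ω = ω)).image (fun a => ({a} : Finset Ω)) ∪
      σ.cycleFactorsFinset.image Equiv.Perm.support := by
  have h1 : ∀ a, σ a = a → blockAux σ a = {a} := by
    intro a ha
    ext b
    rw [mem_blockAux, mem_singleton]
    constructor
    · intro h
      exact (h.eq_of_left ha).symm
    · rintro rfl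
      exact Equiv.Perm.SameCycle.refl _ _
  have h2 : ∀ a, σ a ≠ a → blockAux σ a = (σ.cycleOf a).support := by
    intro a ha
    ext b
    rw [mem_blockAux, Equiv.Perm.mem_support_cycleOf_iff, Equiv.Perm.mem_support]
    simp [ha]
  ext B
  simp only [mem_union, mem_image, mem_filter, mem_univ, true_and]
  constructor
  · rintro ⟨a, rfl⟩
    by_cases ha : σ a = a
    · exact Or.inl ⟨a, ha, (h1 a ha).symm⟩
    · exact Or.inr ⟨σ.cycleOf a, Equiv.Perm.cycleOf_mem_cycleFactorsFinset_iff.2 (by simpa using ha), (h2 a ha).symm⟩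
  · rintro (⟨a, ha, rfl⟩ | ⟨c, hc, rfl⟩)
    · exact ⟨a, h1 a ha⟩
    · obtain ⟨a, ha⟩ := (Equiv.Perm.mem_cycleFactorsFinset_iff.1 hc).1.nonempty_support
      have hs := Equiv.Perm.mem_cycleFactorsFinset_support_le hc ha
      refine ⟨a, ?_⟩
      rw [h2 a (by simpa using hs), ← Equiv.Perm.cycle_is_cycleOf ha hc]

/-- The generating-function identity for `σ`-invariant subsets: for any element `t` of a
commutative ring, the sum of `t^|x|` over all `σ`-invariant subsets `x ⊆ Ω` equals
`(1 + t) ^ j₁(σ) · Π_{k ∈ cycleType σ} (1 + t^k)`, where `j₁(σ)` is the number of fixed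
points of `σ` and `cycleType σ` is the multiset of lengths (≥ 2) of the nontrivial
cycles of `σ`.  (Equivalently, `Σ_m α_m(σ) t^m = Π_{k ≥ 1} (1 + t^k)^{j_k(σ)}`.) -/
theorem stmt_19 {Ω : Type*} [Fintype Ω] [DecidableEq Ω] (σ : Equiv.Perm Ω)
    {R : Type*} [CommRing R] (t : R) :
    ∑ x ∈ (univ : Finset (Finset Ω)).filter (fun x => x.image ⇑σ = x), t ^ x.card =
      (1 + t) ^ ((univ : Finset Ω).filter (fun ω => σ ω = ω)).card *
        (σ.cycleType.map (fun k => 1 + t ^ k)).prod := by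
  rw [sum_inv_aux, blocks_eq_aux, Finset.prod_union, Finset.prod_image, Finset.prod_image]
  · congr 1
    · simp
    · rw [Equiv.Perm.cycleType_def, Multiset.map_map]
      rfl
  · intro c hc d hd h
    obtain ⟨a, ha⟩ := (Equiv.Perm.mem_cycleFactorsFinset_iff.1 hc).1.nonempty_support
    have ha' : a ∈ d.support := by
      rw [← show c.support = d.support from h]
      exact ha
    rw [Equiv.Perm.cycle_is_cycleOf ha hc, Equiv.Perm.cycle_is_cycleOf ha' hd]
  · intro a _ b _ h
    exact singleton_injective h
  · rw [Finset.disjoint_left]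
    intro B h1 h2
    obtain ⟨a, ha, rfl⟩ := mem_image.1 h1
    obtain ⟨c, hc, h⟩ := mem_image.1 h2
    have := (Equiv.Perm.mem_cycleFactorsFinset_iff.1 hc).1.two_le_card_support
    rw [h] at this
    simp at this
end
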